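/- (H_{s,t})_{0≤s<t<∞} is a semigroup of transition probabilities on ([0,∞), B([0,∞))): for all 0 ≤ t₁ < t₂ < t₃ < ∞, all y ≥ 0 and all Borel sets A ⊆ [0,∞), ∫_{[0,∞)} H_{t₂,t₃}(u, A) H_{t₁,t₂}(y, du) = H_{t₁,t₃}(y, A). -/

import Mathlib

open MeasureTheory Filter Set

/-- `C(s,t) = ∫_s^t (σ²(v)/2)·exp(∫_0^v β(u)du) dv` -/
noncomputable def Cf (σ β : ℝ → ℝ) (s t : ℝ) : ℝ :=
  ∫ v in s..t, σ v ^ 2 / 2 * Real.exp (∫ u in (0:ℝ)..v, β u)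

/-- `B(s,t) = exp(−∫_s^t β(v)dv)` -/
noncomputable def Bf (β : ℝ → ℝ) (s t : ℝ) : ℝ :=
  Real.exp (-∫ v in s..t, β v)

/-- `p(s,t) = 1/(B(0,t)·C(s,t))` -/
noncomputable def pf (σ β : ℝ → ℝ) (s t : ℝ) : ℝ :=
  1 / (Bf β 0 t * Cf σ β s t)

/-- `γ(s,t) = 1/(B(0,s)·C(s,t))` -/
noncomputable def gf (σ β : ℝ → ℝ) (s t : ℝ) : ℝ :=
  1 / (Bf β 0 s * Cf σ β s t)

open ProbabilityTheory in
/-- The Poisson(θ)-mixture of Gamma laws: weight `e^{−θ}` on the Dirac measure at `0` and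
weight `e^{−θ}θ^m/m!` on the Gamma law `Γ(m,p)` for `m ≥ 1`. -/
noncomputable def poissonGammaMix (θ p : ℝ) : Measure ℝ :=
  ENNReal.ofReal (Real.exp (-θ)) • Measure.dirac 0 +
  Measure.sum (fun m : ℕ =>
    ENNReal.ofReal (Real.exp (-θ) * θ ^ (m + 1) / (Nat.factorial (m + 1))) •
      gammaMeasure ((m : ℝ) + 1) p)

/-- `H_{s,t}(y,·) = e^{−y·γ(s,t)}·δ₀ + Σ_{m≥1} (e^{−y·γ(s,t)}(y·γ(s,t))^m/m!)·Γ(m,p(s,t))`. -/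
noncomputable def Hm (σ β : ℝ → ℝ) (s t y : ℝ) : Measure ℝ :=
  poissonGammaMix (y * gf σ β s t) (pf σ β s t)

open ProbabilityTheory in
/-- Two finite measures on `ℝ` whose moment generating functions are finite and equal near `0`
coincide. -/
theorem ext_of_lintegral_exp_eq {μ ν : Measure ℝ} [IsFiniteMeasure μ] [IsFiniteMeasure ν]
    {ε : ℝ} (hε : 0 < ε)
    (hfin : ∀ l ∈ Ioo (-ε) ε, ∫⁻ x, ENNReal.ofReal (Real.exp (l * x)) ∂μ ≠ ⊤)
    (heq : ∀ l ∈ Ioo (-ε) ε, ∫⁻ x, ENNReal.ofReal (Real.exp (l * x)) ∂μ =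
      ∫⁻ x, ENNReal.ofReal (Real.exp (l * x)) ∂ν) : μ = ν := by
  have hint (ρ : Measure ℝ)
      (h : ∀ l ∈ Ioo (-ε) ε, ∫⁻ x, ENNReal.ofReal (Real.exp (l * x)) ∂ρ ≠ ⊤) :
      Ioo (-ε) ε ⊆ interior (integrableExpSet id ρ) := by
    refine interior_maximal (fun l hl => ?_) isOpen_Ioo
    rw [integrableExpSet, mem_ofPred_eq]
    exact (lintegral_ofReal_ne_top_iff_integrable (by fun_prop)
      (Eventually.of_forall fun x => (Real.exp_pos _).le)).1 (h l hl)
  have hμ := hint μ hfin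
  have hν := hint ν fun l hl => heq l hl ▸ hfin l hl
  have hmgf : ∀ l ∈ Ioo (-ε) ε, mgf id μ l = mgf id ν l := fun l hl => by
    simp only [mgf, id]
    rw [integral_eq_lintegral_of_nonneg_ae (Eventually.of_forall fun x => (Real.exp_pos _).le)
        (by fun_prop),
      integral_eq_lintegral_of_nonneg_ae (Eventually.of_forall fun x => (Real.exp_pos _).le)
        (by fun_prop), heq l hl]
  have key : EqOn (complexMGF id μ) (complexMGF id ν) {z | z.re ∈ Ioo (-ε) ε} := by
    have hX : AnalyticOnNhd ℂ (complexMGF id μ) {z | z.re ∈ Ioo (-ε) ε} :=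
      analyticOnNhd_complexMGF.mono fun z hz => hμ hz
    have hY : AnalyticOnNhd ℂ (complexMGF id ν) {z | z.re ∈ Ioo (-ε) ε} :=
      analyticOnNhd_complexMGF.mono fun z hz => hν hz
    refine hX.eqOn_of_preconnected_of_frequently_eq hY
      ((convex_Ioo (-ε) ε).linear_preimage Complex.reLm).isPreconnected
      (z₀ := 0) (by simp [hε]) ?_
    have hev : ∀ᶠ x : ℝ in nhdsWithin 0 {0}ᶜ, complexMGF id μ x = complexMGF id ν x := by
      filter_upwards [nhdsWithin_le_nhds (Ioo_mem_nhds (neg_neg_of_pos hε) hε)] with x hx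
      rw [complexMGF_ofReal, complexMGF_ofReal, hmgf x hx]
    have htend : Tendsto (fun x : ℝ => (x : ℂ)) (nhdsWithin 0 {0}ᶜ) (nhdsWithin 0 {0}ᶜ) := by
      refine tendsto_nhdsWithin_iff.2 ⟨?_, ?_⟩
      · exact (Complex.continuous_ofReal.tendsto' 0 0 (by simp)).mono_left nhdsWithin_le_nhds
      · filter_upwards [self_mem_nhdsWithin] with x hx
        simpa using hx
    exact htend.frequently hev.frequently
  refine Measure.ext_of_charFun (funext fun t => ?_)
  rw [← complexMGF_id_mul_I, ← complexMGF_id_mul_I]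
  exact key (by simp [hε])

open ProbabilityTheory in
theorem measurable_gammaPDF (a p : ℝ) : Measurable (gammaPDF a p) :=
  (measurable_gammaPDFReal a p).ennreal_ofReal

open ProbabilityTheory in
theorem lintegral_exp_gammaMeasure {a p l : ℝ} (ha : 0 < a) (hp : 0 < p) (hl : l < p) :
    ∫⁻ x, ENNReal.ofReal (Real.exp (l * x)) ∂(gammaMeasure a p) =
      ENNReal.ofReal ((p / (p - l)) ^ a) := by
  have hpl : 0 < p - l := sub_pos.2 hl
  rw [gammaMeasure, lintegral_withDensity_eq_lintegral_mul _
    (measurable_gammaPDF a p) (by fun_prop)]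
  have h (x : ℝ) : (gammaPDF a p * fun x => ENNReal.ofReal (Real.exp (l * x))) x =
      ENNReal.ofReal ((p / (p - l)) ^ a) * gammaPDF a (p - l) x := by
    rw [Pi.mul_apply, gammaPDF, gammaPDF, ← ENNReal.ofReal_mul (gammaPDFReal_nonneg ha hp x),
      ← ENNReal.ofReal_mul (by positivity)]
    congr 1
    unfold gammaPDFReal
    split_ifs
    · have he : Real.exp (-((p - l) * x)) = Real.exp (-(p * x)) * Real.exp (l * x) := by
        rw [← Real.exp_add]; ring_nf
      rw [he, Real.div_rpow hp.le hpl.le]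
      have := (Real.rpow_pos_of_pos hpl a).ne'
      field_simp
    · simp
  simp_rw [h]
  rw [lintegral_const_mul _ (measurable_gammaPDF a _),
    lintegral_gammaPDF_eq_one ha hpl, mul_one]

theorem lintegral_exp_poissonGammaMix {θ p l : ℝ} (hθ : 0 ≤ θ) (hp : 0 < p) (hl : l < p) :
    ∫⁻ x, ENNReal.ofReal (Real.exp (l * x)) ∂(poissonGammaMix θ p) =
      ENNReal.ofReal (Real.exp (θ * l / (p - l))) := by
  have hpl : 0 < p - l := sub_pos.2 hl
  set r := p / (p - l) with hr
  have hr0 : 0 < r := by positivity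
  let f : ℕ → ℝ := fun n => Real.exp (-θ) * ((θ * r) ^ n / n.factorial)
  have hf0 : ∀ n, 0 ≤ f n := fun n => by positivity
  have hf : HasSum f (Real.exp (θ * l / (p - l))) := by
    have h := (NormedSpace.expSeries_div_hasSum_exp (θ * r)).mul_left (Real.exp (-θ))
    rw [← Real.exp_eq_exp_ℝ, ← Real.exp_add] at h
    have he : -θ + θ * r = θ * l / (p - l) := by
      rw [hr]
      field_simp
      ring
    rwa [he] at h
  rw [poissonGammaMix, lintegral_add_measure, lintegral_sum_measure, lintegral_smul_measure,
    lintegral_dirac' _ (by fun_prop), ← hf.tsum_eq, ENNReal.ofReal_tsum_of_nonneg hf0 hf.summable,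
    tsum_eq_zero_add' (f := fun n => ENNReal.ofReal (f n)) ENNReal.summable]
  congr 1
  · simp [f]
  · refine tsum_congr fun m => ?_
    rw [lintegral_smul_measure, lintegral_exp_gammaMeasure (by positivity) hp hl, smul_eq_mul,
      ← ENNReal.ofReal_mul (by positivity)]
    congr 1
    have : (r : ℝ) ^ ((m : ℝ) + 1) = r ^ (m + 1) := by exact_mod_cast Real.rpow_natCast r (m + 1)
    rw [this]
    simp only [f, mul_pow]
    ring

theorem isProbabilityMeasure_poissonGammaMix {θ p : ℝ} (hθ : 0 ≤ θ) (hp : 0 < p) :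
    IsProbabilityMeasure (poissonGammaMix θ p) :=
  ⟨by simpa using lintegral_exp_poissonGammaMix hθ hp hp⟩

open ProbabilityTheory in
theorem ae_nonneg_poissonGammaMix (θ p : ℝ) : ∀ᵐ x ∂(poissonGammaMix θ p), 0 ≤ x := by
  rw [poissonGammaMix, ae_add_measure_iff]
  constructor
  · refine Measure.ae_smul_measure ?_ _
    rw [ae_dirac_iff (measurableSet_Ici (a := (0 : ℝ)))]
  · rw [Measure.ae_sum_iff]
    refine fun m => Measure.ae_smul_measure ?_ _
    rw [gammaMeasure, ae_withDensity_iff (measurable_gammaPDF _ _)]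
    refine Eventually.of_forall fun x hx => ?_
    by_contra h
    exact hx (gammaPDF_of_neg (not_le.1 h))

theorem measurable_poissonGammaMix (p : ℝ) : Measurable fun θ => poissonGammaMix θ p := by
  refine Measure.measurable_of_measurable_coe _ fun s hs => ?_
  simp only [poissonGammaMix, Measure.add_apply, Measure.smul_apply, Measure.sum_apply _ hs,
    smul_eq_mul]
  refine Measurable.add (by fun_prop) (Measurable.tsum fun m => by fun_prop)

theorem bind_poissonGammaMix {θ p g q : ℝ} (hθ : 0 ≤ θ) (hp : 0 < p) (hg : 0 < g) (hq : 0 < q) :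
    (poissonGammaMix θ p).bind (fun u => poissonGammaMix (u * g) q) =
      poissonGammaMix (θ * g / (p + g)) (p * q / (p + g)) := by
  have hmeas : Measurable fun u => poissonGammaMix (u * g) q :=
    (measurable_poissonGammaMix q).comp (measurable_id.mul_const g)
  have hθ' : 0 ≤ θ * g / (p + g) := by positivity
  have hp' : 0 < p * q / (p + g) := by positivity
  have hlap : ∀ l < p * q / (p + g), ∫⁻ x, ENNReal.ofReal (Real.exp (l * x))
      ∂((poissonGammaMix θ p).bind (fun u => poissonGammaMix (u * g) q)) =
      ∫⁻ x, ENNReal.ofReal (Real.exp (l * x))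
        ∂(poissonGammaMix (θ * g / (p + g)) (p * q / (p + g))) := by
    intro l hl
    have hl' : l * (p + g) < p * q := (lt_div_iff₀ (by positivity)).1 hl
    have hlq : l < q := hl.trans ((div_lt_iff₀ (by positivity)).2 (by nlinarith))
    have hql : 0 < q - l := sub_pos.2 hlq
    have hlp : g * l / (q - l) < p := (div_lt_iff₀ hql).2 (by nlinarith)
    rw [Measure.lintegral_bind hmeas.aemeasurable (by fun_prop),
      lintegral_exp_poissonGammaMix hθ' hp' hl]
    have : ∫⁻ u, ∫⁻ x, ENNReal.ofReal (Real.exp (l * x)) ∂(poissonGammaMix (u * g) q)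
        ∂(poissonGammaMix θ p) =
        ∫⁻ u, ENNReal.ofReal (Real.exp (g * l / (q - l) * u)) ∂(poissonGammaMix θ p) := by
      refine lintegral_congr_ae ?_
      filter_upwards [ae_nonneg_poissonGammaMix θ p] with u hu
      rw [lintegral_exp_poissonGammaMix (mul_nonneg hu hg.le) hq hlq]
      ring_nf
    rw [this, lintegral_exp_poissonGammaMix hθ hp hlp]
    congr 2
    have h1 : p - g * l / (q - l) = (p * q - l * (p + g)) / (q - l) := by
      field_simp
      ring
    have h2 : p * q / (p + g) - l = (p * q - l * (p + g)) / (p + g) := by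
      field_simp
    have h3 : p * q - l * (p + g) ≠ 0 := (sub_pos.2 hl').ne'
    rw [h1, h2]
    field_simp
  have := isProbabilityMeasure_poissonGammaMix hθ' hp'
  have hprob : IsProbabilityMeasure
      ((poissonGammaMix θ p).bind (fun u => poissonGammaMix (u * g) q)) :=
    ⟨by simpa using hlap 0 hp'⟩
  refine ext_of_lintegral_exp_eq hp' (fun l hl => ?_) (fun l hl => hlap l hl.2)
  rw [hlap l hl.2, lintegral_exp_poissonGammaMix hθ' hp' hl.2]
  exact ENNReal.ofReal_ne_top

theorem continuousOn_Cf_integrand {σ β : ℝ → ℝ} (hσ : ContinuousOn σ (Ici 0))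
    (hβ : ContinuousOn β (Ici 0)) {t : ℝ} (ht : 0 ≤ t) :
    ContinuousOn (fun v => σ v ^ 2 / 2 * Real.exp (∫ u in (0 : ℝ)..v, β u)) (Icc 0 t) := by
  have hprim : ContinuousOn (fun v => ∫ u in (0 : ℝ)..v, β u) (Icc 0 t) := by
    rw [← uIcc_of_le ht]
    refine intervalIntegral.continuousOn_primitive_interval ?_
    rw [uIcc_of_le ht]
    exact (hβ.mono Icc_subset_Ici_self).integrableOn_Icc
  exact (((hσ.mono Icc_subset_Ici_self).pow 2).div_const 2).mul hprim.rexp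

theorem intervalIntegrable_Cf_integrand {σ β : ℝ → ℝ} (hσ : ContinuousOn σ (Ici 0))
    (hβ : ContinuousOn β (Ici 0)) {s t : ℝ} (hs : 0 ≤ s) (hst : s ≤ t) :
    IntervalIntegrable (fun v => σ v ^ 2 / 2 * Real.exp (∫ u in (0 : ℝ)..v, β u)) volume s t :=
  ((continuousOn_Cf_integrand hσ hβ (hs.trans hst)).mono
    (Icc_subset_Icc_left hs)).intervalIntegrable_of_Icc hst

theorem Cf_pos {σ β : ℝ → ℝ} (hσ : ContinuousOn σ (Ici 0)) (hβ : ContinuousOn β (Ici 0))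
    (hσpos : ∀ x ∈ Ici (0 : ℝ), 0 < σ x) {s t : ℝ} (hs : 0 ≤ s) (hst : s < t) :
    0 < Cf σ β s t := by
  refine intervalIntegral.intervalIntegral_pos_of_pos_on
    (intervalIntegrable_Cf_integrand hσ hβ hs hst.le) (fun v hv => ?_) hst
  have := hσpos v (hs.trans hv.1.le)
  positivity

theorem Cf_add {σ β : ℝ → ℝ} (hσ : ContinuousOn σ (Ici 0)) (hβ : ContinuousOn β (Ici 0))
    {r s t : ℝ} (hr : 0 ≤ r) (hrs : r ≤ s) (hst : s ≤ t) :
    Cf σ β r s + Cf σ β s t = Cf σ β r t :=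
  intervalIntegral.integral_add_adjacent_intervals
    (intervalIntegrable_Cf_integrand hσ hβ hr hrs)
    (intervalIntegrable_Cf_integrand hσ hβ (hr.trans hrs) hst)

/-- Chapman–Kolmogorov / semigroup property of `(H_{s,t})`:
`∫ H_{t₂,t₃}(u,A) H_{t₁,t₂}(y,du) = H_{t₁,t₃}(y,A)` for all Borel `A`. -/
theorem stmt_11 (σ β : ℝ → ℝ)
    (hσc : ContinuousOn σ (Set.Ici 0)) (hβc : ContinuousOn β (Set.Ici 0))
    (hσpos : ∀ x ∈ Set.Ici (0:ℝ), 0 < σ x) (hβnn : ∀ x ∈ Set.Ici (0:ℝ), 0 ≤ β x)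
    (t₁ t₂ t₃ : ℝ) (h₁ : 0 ≤ t₁) (h₁₂ : t₁ < t₂) (h₂₃ : t₂ < t₃)
    (y : ℝ) (hy : 0 ≤ y) (A : Set ℝ) (hA : MeasurableSet A) :
    (∫⁻ u, Hm σ β t₂ t₃ u A ∂(Hm σ β t₁ t₂ y)) = Hm σ β t₁ t₃ y A := by
  have hC₁₂ := Cf_pos hσc hβc hσpos h₁ h₁₂
  have hC₂₃ := Cf_pos hσc hβc hσpos (h₁.trans h₁₂.le) h₂₃
  have hB (t : ℝ) : 0 < Bf β 0 t := Real.exp_pos _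
  have hB₁ := hB t₁
  have hB₂ := hB t₂
  have hB₃ := hB t₃
  have hmeas : Measurable fun u => Hm σ β t₂ t₃ u :=
    (measurable_poissonGammaMix _).comp (measurable_id.mul_const _)
  rw [← Measure.bind_apply hA hmeas.aemeasurable]
  have hg₁₂ : 0 < gf σ β t₁ t₂ := by unfold gf; positivity
  have hp₁₂ : 0 < pf σ β t₁ t₂ := by unfold pf; positivity
  have hg₂₃ : 0 < gf σ β t₂ t₃ := by unfold gf; positivity
  have hp₂₃ : 0 < pf σ β t₂ t₃ := by unfold pf; positivity
  have hθ : y * gf σ β t₁ t₂ * gf σ β t₂ t₃ / (pf σ β t₁ t₂ + gf σ β t₂ t₃) =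
      y * gf σ β t₁ t₃ := by
    unfold gf pf
    rw [← Cf_add hσc hβc h₁ h₁₂.le h₂₃.le]
    field_simp
    ring
  have hp : pf σ β t₁ t₂ * pf σ β t₂ t₃ / (pf σ β t₁ t₂ + gf σ β t₂ t₃) = pf σ β t₁ t₃ := by
    unfold gf pf
    rw [← Cf_add hσc hβc h₁ h₁₂.le h₂₃.le]
    field_simp
    ring
  have h := bind_poissonGammaMix (mul_nonneg hy hg₁₂.le) hp₁₂ hg₂₃ hp₂₃
  rw [hθ, hp] at h
  exact congrArg (fun μ : Measure ℝ => μ A) h
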